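/- Sufficient condition for Hermitianness (i): with the Hartwig–Spindelböck decomposition data as in the context and Â^N := Û · fromBlocks(K*Σ₁⁻¹, 0, L*Σ₁⁻¹, 0) · Û* (the NDMPI of Â), if Â·Â·Â^N = Â*, then Â is Hermitian (Â* = Â). -/

import Mathlib

open Matrix

/-- The dual complex numbers `𝔻ℂ := ℂ[ε]`, the trivial square-zero extension of `ℂ` by `ℂ`. -/
abbrev DC := TrivSqZeroExt ℂ ℂ

/-- Star on dual complex numbers: `(a + b·ε)* = conj a + conj b · ε`. -/
instance : Star DC :=
  ⟨fun x => ((starRingEnd ℂ) x.fst, (starRingEnd ℂ) x.snd)⟩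

/-- A positive appreciable real dual number: the standard part is a positive real and
the dual part is real. -/
def PosAppreciable (x : DC) : Prop :=
  (∃ a : ℝ, 0 < a ∧ x.fst = (a : ℂ)) ∧ (∃ b : ℝ, x.snd = (b : ℂ))

/-- A nonnegative infinitesimal real dual number: the standard part is `0` and
the dual part is a nonnegative real. -/
def NonnegInfinitesimal (x : DC) : Prop :=
  x.fst = 0 ∧ ∃ b : ℝ, 0 ≤ b ∧ x.snd = (b : ℂ)

/-- The standard part of a dual complex matrix. -/
def stdPart {m n : Type*} (X : Matrix m n DC) : Matrix m n ℂ :=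
  X.map TrivSqZeroExt.fst

/-- The dual part of a dual complex matrix. -/
def dualPart {m n : Type*} (X : Matrix m n DC) : Matrix m n ℂ :=
  X.map TrivSqZeroExt.snd

instance : StarRing DC where
  star_involutive x := TrivSqZeroExt.ext (Complex.conj_conj x.fst) (Complex.conj_conj x.snd)
  star_mul x y := by
    refine TrivSqZeroExt.ext ?_ ?_
    · change (starRingEnd ℂ) (x * y).fst = (starRingEnd ℂ) y.fst * (starRingEnd ℂ) x.fst
      rw [TrivSqZeroExt.fst_mul, map_mul, mul_comm]
    · change (starRingEnd ℂ) (x * y).snd = (starRingEnd ℂ) y.fst * (starRingEnd ℂ) x.snd +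
        (starRingEnd ℂ) y.snd * (starRingEnd ℂ) x.fst
      simp [TrivSqZeroExt.snd_mul, mul_comm, add_comm]
  star_add x y := TrivSqZeroExt.ext (map_add (starRingEnd ℂ) x.fst y.fst)
    (map_add (starRingEnd ℂ) x.snd y.snd)

theorem PosAppreciable.isUnit {x : DC} (hx : PosAppreciable x) : IsUnit x := by
  obtain ⟨⟨a, ha, hxa⟩, -⟩ := hx
  rw [TrivSqZeroExt.isUnit_iff_isUnit_fst, hxa]
  exact isUnit_iff_ne_zero.mpr (Complex.ofReal_ne_zero.mpr ha.ne')

/-- If `a * p = star a` for a self-adjoint idempotent `p`, then `a` is self-adjoint. -/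
theorem IsStarProjection.star_eq_of_mul_eq_star {R : Type*} [Semiring R] [StarRing R] {a p : R}
    (hp : IsStarProjection p) (h : a * p = star a) : star a = a := by
  have hpp : p * p = p := hp.isIdempotentElem
  have hstar : p * star a = a := by
    simpa [hp.isSelfAdjoint.star_eq] using congrArg star h
  have hcompress : p * (a * p) = a := by rw [h, hstar]
  rw [← h]
  calc a * p = p * (a * p) * p := by rw [hcompress]
    _ = p * (a * (p * p)) := by simp only [mul_assoc]
    _ = a := by rw [hpp, hcompress]

/-- Sufficient condition for Hermitianness (i). -/
theorem hermitian_of_mul_mul_ndmpi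
    {r s : ℕ}
    -- `Û`, a unitary matrix
    (U : Matrix (Fin r ⊕ Fin s) (Fin r ⊕ Fin s) DC)
    (hU₁ : U * Uᴴ = 1) (hU₂ : Uᴴ * U = 1)
    -- the blocks `K, L, M, N` forming a unitary block matrix
    (K : Matrix (Fin r) (Fin r) DC) (L : Matrix (Fin r) (Fin s) DC)
    (M : Matrix (Fin s) (Fin r) DC) (N : Matrix (Fin s) (Fin s) DC)
    (hW₁ : fromBlocks K L M N * (fromBlocks K L M N)ᴴ = 1)
    (hW₂ : (fromBlocks K L M N)ᴴ * fromBlocks K L M N = 1)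
    -- `Σ₁` diagonal with positive appreciable real dual diagonal entries
    (S₁ : Matrix (Fin r) (Fin r) DC) (d₁ : Fin r → DC)
    (hS₁ : S₁ = Matrix.diagonal d₁) (hd₁ : ∀ i, PosAppreciable (d₁ i))
    -- `Σ₂` diagonal with nonnegative infinitesimal real dual diagonal entries
    (S₂ : Matrix (Fin s) (Fin s) DC) (d₂ : Fin s → DC)
    (hS₂ : S₂ = Matrix.diagonal d₂) (hd₂ : ∀ i, NonnegInfinitesimal (d₂ i))
    -- the Hartwig–Spindelböck decomposition of `Â`
    (A : Matrix (Fin r ⊕ Fin s) (Fin r ⊕ Fin s) DC)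
    (hA : A = U * fromBlocks (S₁ * K) (S₁ * L) (S₂ * M) (S₂ * N) * Uᴴ)
    -- `Â^N`, the NDMPI of `Â`
    (AN : Matrix (Fin r ⊕ Fin s) (Fin r ⊕ Fin s) DC)
    (hAN : AN = U * fromBlocks (Kᴴ * S₁⁻¹) 0 (Lᴴ * S₁⁻¹) 0 * Uᴴ)
    (h : A * A * AN = Aᴴ) :
    Aᴴ = A := by
  have hdet : IsUnit S₁.det := by
    rw [hS₁, det_diagonal]
    exact IsUnit.prod_iff.mpr fun i _ => (hd₁ i).isUnit
  have hS₁inv : S₁ * S₁⁻¹ = 1 := mul_nonsing_inv S₁ hdet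
  rw [fromBlocks_conjTranspose, fromBlocks_multiply, ← fromBlocks_one, fromBlocks_inj] at hW₁
  obtain ⟨hKL, -, hMN, -⟩ := hW₁
  have hblocks : fromBlocks (S₁ * K) (S₁ * L) (S₂ * M) (S₂ * N) *
      fromBlocks (Kᴴ * S₁⁻¹) 0 (Lᴴ * S₁⁻¹) 0 =
      (fromBlocks 1 0 0 0 : Matrix (Fin r ⊕ Fin s) (Fin r ⊕ Fin s) DC) := by
    have h₁₁ : S₁ * K * (Kᴴ * S₁⁻¹) + S₁ * L * (Lᴴ * S₁⁻¹) =
        S₁ * (K * Kᴴ + L * Lᴴ) * S₁⁻¹ := by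
      simp only [Matrix.mul_add, Matrix.add_mul, Matrix.mul_assoc]
    have h₂₁ : S₂ * M * (Kᴴ * S₁⁻¹) + S₂ * N * (Lᴴ * S₁⁻¹) =
        S₂ * (M * Kᴴ + N * Lᴴ) * S₁⁻¹ := by
      simp only [Matrix.mul_add, Matrix.add_mul, Matrix.mul_assoc]
    rw [fromBlocks_multiply, h₁₁, h₂₁, hKL, hMN]
    simp [hS₁inv]
  have hQ : A * AN = U * fromBlocks 1 0 0 0 * Uᴴ := by
    rw [hA, hAN, ← hblocks]
    simp only [Matrix.mul_assoc]
    rw [← Matrix.mul_assoc Uᴴ U, hU₂, Matrix.one_mul]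
  have hproj : IsStarProjection (A * AN) := by
    rw [hQ]
    refine ⟨?_, ?_⟩
    · change U * fromBlocks 1 0 0 0 * Uᴴ * (U * fromBlocks 1 0 0 0 * Uᴴ) = _
      simp only [Matrix.mul_assoc]
      rw [← Matrix.mul_assoc Uᴴ U, hU₂, Matrix.one_mul, ← Matrix.mul_assoc (fromBlocks 1 0 0 0),
        fromBlocks_multiply]
      simp
    · rw [isSelfAdjoint_iff, star_eq_conjTranspose]
      simp [conjTranspose_mul, fromBlocks_conjTranspose, Matrix.mul_assoc]
  exact hproj.star_eq_of_mul_eq_star (by rw [← mul_assoc, h, star_eq_conjTranspose])
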